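/- arXiv:1902.01508 — 7 statements merged into one kernel-verified Lean document; each statement's English description precedes it below -/
import Mathlib

section
/- Let b : ℕ → ℕ with b(i) ≥ 1 for all i, and let (𝕋, ≤) be a b-tree forcing notion. Let D ⊆ ω^ω be a dominating family consisting of increasing functions, and for each f ∈ D let σ^f : ℕ → seq(b) be a sequence with |σ^f(n)| = f*(n) for all n. Then for every T ∈ 𝕋 there exist S ∈ 𝕋 with S ≤ T and f ∈ D such that [σ^f]_∞ ∩ [S] = ∅. -/
/-- `∏b`: the set of `x : ℕ → ℕ` with `x i < b i` for all `i`. -/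
def prodSet (b : ℕ → ℕ) : Set (ℕ → ℕ) := {x | ∀ i, x i < b i}

/-- `s ∈ seq(b)`: a finite sequence with `s i < b i` for all `i < |s|`. -/
def IsBSeq (b : ℕ → ℕ) (s : List ℕ) : Prop := ∀ i : Fin s.length, s.get i < b i

/-- `s` is an initial segment of `x : ℕ → ℕ`. -/
def IsInit (s : List ℕ) (x : ℕ → ℕ) : Prop := ∀ i : Fin s.length, s.get i = x i

/-- A tree: contains the empty sequence and is closed under initial segments. -/
def IsTree (T : Set (List ℕ)) : Prop :=
  [] ∈ T ∧ ∀ t ∈ T, ∀ s : List ℕ, s <+: t → s ∈ T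

/-- `Lv n T`: the elements of `T` of length `n`. -/
def Lv (n : ℕ) (T : Set (List ℕ)) : Set (List ℕ) := {t ∈ T | t.length = n}

/-- `T^s := {t ∈ T : s ⊆ t or t ⊆ s}`. -/
def restr (T : Set (List ℕ)) (s : List ℕ) : Set (List ℕ) :=
  {t ∈ T | s <+: t ∨ t <+: s}

/-- `s` is a splitting node of `T`: `s ∈ T` with at least two immediate successors in `T`. -/
def IsSplit (T : Set (List ℕ)) (s : List ℕ) : Prop :=
  s ∈ T ∧ ∃ i j : ℕ, i ≠ j ∧ s ++ [i] ∈ T ∧ s ++ [j] ∈ T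

/-- `spl_n(T)`: the splitting nodes of `T` with exactly `n` splitting nodes strictly
below them. -/
def spln (n : ℕ) (T : Set (List ℕ)) : Set (List ℕ) :=
  {s | IsSplit T s ∧ {t | IsSplit T t ∧ t <+: s ∧ t ≠ s}.ncard = n}

/-- `T' ⊆_n T`: `T' ⊆ T` and there is `m` such that all elements of `spl_n(T)` have
length `< m` and `T'` and `T` contain the same sequences of length `m`. -/
def SubN (n : ℕ) (T' T : Set (List ℕ)) : Prop :=
  T' ⊆ T ∧ ∃ m : ℕ, (∀ s ∈ spln n T, s.length < m) ∧
    ∀ u : List ℕ, u.length = m → (u ∈ T' ↔ u ∈ T)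

/-- `[T]`: the set of infinite branches of `T`. -/
def branches (T : Set (List ℕ)) : Set (ℕ → ℕ) :=
  {x | ∀ n, (List.ofFn fun i : Fin n => x i) ∈ T}

/-- `[σ]_∞`: the set of `x ∈ ∏b` such that `σ n` is an initial segment of `x`
for infinitely many `n`. -/
def limsupCyl (b : ℕ → ℕ) (σ : ℕ → List ℕ) : Set (ℕ → ℕ) :=
  {x ∈ prodSet b | ∀ m, ∃ n ≥ m, IsInit (σ n) x}

/-- `f ≤* g`: `f n ≤ g n` for all but finitely many `n`. -/
def LeStar (f g : ℕ → ℕ) : Prop := ∀ᶠ n in Filter.atTop, f n ≤ g n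

/-- `f*`: `f* 0 = 0`, `f* (n+1) = f (f* n + 1)`. -/
def fstar (f : ℕ → ℕ) : ℕ → ℕ
  | 0 => 0
  | n + 1 => f (fstar f n + 1)

/-- A `b`-tree forcing notion: a partially ordered set `(𝕋, ≤)` of trees contained in
`seq(b)` satisfying (T1)–(T6). -/
structure BTreeForcing (b : ℕ → ℕ) where
  /-- The set of conditions. -/
  mem : Set (Set (List ℕ))
  /-- The order on conditions. -/
  le : Set (List ℕ) → Set (List ℕ) → Prop
  nonempty : mem.Nonempty
  le_refl : ∀ T ∈ mem, le T T
  le_trans : ∀ T₁ ∈ mem, ∀ T₂ ∈ mem, ∀ T₃ ∈ mem, le T₁ T₂ → le T₂ T₃ → le T₁ T₃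
  le_antisymm : ∀ T₁ ∈ mem, ∀ T₂ ∈ mem, le T₁ T₂ → le T₂ T₁ → T₁ = T₂
  /-- (T1) every condition is a tree contained in `seq(b)`. -/
  tree : ∀ T ∈ mem, IsTree T ∧ ∀ s ∈ T, IsBSeq b s
  /-- (T2) every node of a condition is extended by a splitting node. -/
  split : ∀ T ∈ mem, ∀ s ∈ T, ∃ t, s <+: t ∧ IsSplit T t
  /-- (T3) `T' ≤ T` implies `T' ⊆ T`. -/
  le_sub : ∀ T' ∈ mem, ∀ T ∈ mem, le T' T → T' ⊆ T
  /-- (T4) restrictions `T^s` are conditions below `T`. -/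
  restr_mem : ∀ T ∈ mem, ∀ s ∈ T, restr T s ∈ mem ∧ le (restr T s) T
  /-- (T5) amalgamation over a level. -/
  amalg : ∀ T ∈ mem, ∀ n : ℕ, ∀ S : List ℕ → Set (List ℕ),
    (∀ t ∈ Lv n T, S t ∈ mem ∧ le (S t) (restr T t)) →
    (⋃ t ∈ Lv n T, S t) ∈ mem ∧ le (⋃ t ∈ Lv n T, S t) T
  /-- (T6) fusion. -/
  fusion : ∀ T : ℕ → Set (List ℕ), (∀ n, T n ∈ mem) →
    (∀ n, le (T (n + 1)) (T n)) → (∀ n, SubN n (T (n + 1)) (T n)) →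
    (⋂ n, T n) ∈ mem ∧ ∀ n, le (⋂ n, T n) (T n)

/-- A tree splits doubly between the levels `m` and `N` if every node of length `m` is extended by
two incomparable splitting nodes of length less than `N`. -/
def DoublySplits (T : Set (List ℕ)) (m N : ℕ) : Prop :=
  ∀ u ∈ T, u.length = m → ∃ t₀ t₁, IsSplit T t₀ ∧ IsSplit T t₁ ∧ u <+: t₀ ∧ u <+: t₁ ∧
    t₀.length < N ∧ t₁.length < N ∧ ¬ t₀ <+: t₁ ∧ ¬ t₁ <+: t₀

/-- Every node of length at least `m` has at least `k` splitting nodes of length less than `m`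
below it. -/
def SplitsOften (T : Set (List ℕ)) (m k : ℕ) : Prop :=
  ∀ v ∈ T, m ≤ v.length → k ≤ {t | IsSplit T t ∧ t <+: v ∧ t.length < m}.ncard

/-- `A` contains all extensions in `T` of those nodes of `A` that have length at least `m`. -/
def FullAbove (T A : Set (List ℕ)) (m : ℕ) : Prop :=
  ∀ v ∈ A, m ≤ v.length → ∀ w ∈ T, v <+: w → w ∈ A

theorem finite_prefixes (v : List ℕ) : {t : List ℕ | t <+: v}.Finite := by
  refine (List.finite_toSet v.inits).subset fun t ht => ?_
  simpa using ht

theorem finite_bSeq_length (b : ℕ → ℕ) (n : ℕ) :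
    {s : List ℕ | IsBSeq b s ∧ s.length = n}.Finite := by
  refine ((Set.finite_Iic (fun i : Fin n => b i)).image List.ofFn).subset ?_
  rintro s ⟨hs, rfl⟩
  exact ⟨s.get, fun i => (hs i).le, List.ofFn_get s⟩

theorem IsTree.mem_of_prefix {T : Set (List ℕ)} (hT : IsTree T) {s t : List ℕ} (ht : t ∈ T)
    (h : s <+: t) : s ∈ T :=
  hT.2 t ht s h

theorem IsSplit.of_fullAbove {T A : Set (List ℕ)} {m : ℕ} (hA : FullAbove T A m) {u t : List ℕ}
    (hu : u ∈ A) (hm : m ≤ u.length) (hut : u <+: t) (ht : IsSplit T t) : IsSplit A t := by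
  obtain ⟨htT, i, j, hij, hi, hj⟩ := ht
  have key : ∀ w ∈ T, t <+: w → w ∈ A := fun w hw h => hA u hu hm w hw (hut.trans h)
  exact ⟨key _ htT List.prefix_rfl, i, j, hij, key _ hi (List.prefix_append _ _),
    key _ hj (List.prefix_append _ _)⟩

theorem DoublySplits.of_fullAbove {T A : Set (List ℕ)} {m N : ℕ} (hT : DoublySplits T m N)
    (hAT : A ⊆ T) (hA : FullAbove T A m) : DoublySplits A m N := by
  intro u hu hm
  obtain ⟨t₀, t₁, h₀, h₁, hu₀, hu₁, h⟩ := hT u (hAT hu) hm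
  exact ⟨t₀, t₁, h₀.of_fullAbove hA hu hm.ge hu₀, h₁.of_fullAbove hA hu hm.ge hu₁, hu₀, hu₁, h⟩

theorem DoublySplits.mono {T : Set (List ℕ)} {m N N' : ℕ} (h : DoublySplits T m N)
    (hN : N ≤ N') : DoublySplits T m N' := by
  intro u hu hm
  obtain ⟨t₀, t₁, h₀, h₁, hu₀, hu₁, hl₀, hl₁, hc⟩ := h u hu hm
  exact ⟨t₀, t₁, h₀, h₁, hu₀, hu₁, hl₀.trans_le hN, hl₁.trans_le hN, hc⟩

/-- Splitting nodes of `spl_n` are short in a tree that splits often enough. -/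
theorem SplitsOften.length_lt {T : Set (List ℕ)} {m n : ℕ} (h : SplitsOften T m (n + 1))
    {s : List ℕ} (hs : s ∈ spln n T) : s.length < m := by
  by_contra! hm
  have h₁ := h s hs.1.1 hm
  have h₂ : {t | IsSplit T t ∧ t <+: s ∧ t.length < m}.ncard ≤
      {t | IsSplit T t ∧ t <+: s ∧ t ≠ s}.ncard := by
    refine Set.ncard_le_ncard ?_ ((finite_prefixes s).subset fun t ht => ht.2.1)
    rintro t ⟨h₁, h₂, h₃⟩
    refine ⟨h₁, h₂, ?_⟩
    rintro rfl
    omega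
  have h₃ := hs.2
  omega

theorem SplitsOften.succ {A A' : Set (List ℕ)} {m m' k : ℕ} (h : SplitsOften A m k)
    (hsub : A' ⊆ A) (hmm : m ≤ m') (hkeep : ∀ u ∈ A, u.length ≤ m → u ∈ A')
    (hsplit : ∀ v ∈ A', m' ≤ v.length →
      ∃ t, IsSplit A' t ∧ t <+: v ∧ m ≤ t.length ∧ t.length < m') :
    SplitsOften A' m' (k + 1) := by
  intro v hv hvm
  obtain ⟨t, ht, htv, hmt, htm⟩ := hsplit v hv hvm
  have hfin : {t | IsSplit A t ∧ t <+: v ∧ t.length < m}.Finite :=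
    (finite_prefixes v).subset fun t ht => ht.2.1
  have hnot : t ∉ {t | IsSplit A t ∧ t <+: v ∧ t.length < m} := fun h => by
    have := h.2.2
    omega
  have hcard := h v (hsub hv) (hmm.trans hvm)
  rw [← Nat.add_le_add_iff_right (n := 1), ← Set.ncard_insert_of_notMem hnot hfin] at hcard
  refine hcard.trans (Set.ncard_le_ncard ?_ ((finite_prefixes v).subset fun t ht => ht.2.1))
  rintro s (rfl | ⟨⟨hsA, i, j, hij, hi, hj⟩, hsv, hsm⟩)
  · exact ⟨ht, htv, htm⟩
  · exact ⟨⟨hkeep s hsA hsm.le, i, j, hij, hkeep _ hi (by simpa using hsm),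
      hkeep _ hj (by simpa using hsm)⟩, hsv, hsm.trans_le hmm⟩

theorem le_fstar {f : ℕ → ℕ} (hf : StrictMono f) (n : ℕ) : n ≤ fstar f n := by
  induction n with
  | zero => exact Nat.zero_le _
  | succ n ih =>
    have := hf.id_le (fstar f n + 1)
    simp only [id, fstar] at this ⊢
    omega

namespace BTreeForcing

variable {b : ℕ → ℕ} (𝕋 : BTreeForcing b) {T : Set (List ℕ)}

theorem exists_prefix_length_eq (hT : T ∈ 𝕋.mem) {u : List ℕ} (hu : u ∈ T) {m : ℕ}
    (hm : u.length ≤ m) : ∃ v ∈ T, u <+: v ∧ v.length = m := by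
  induction m, hm using Nat.le_induction with
  | base => exact ⟨u, hu, List.prefix_rfl, rfl⟩
  | succ m _ ih =>
    obtain ⟨v, hv, huv, rfl⟩ := ih
    obtain ⟨t, hvt, -, i, -, -, hi, -⟩ := 𝕋.split T hT v hv
    have hlen : v.length + 1 ≤ (t ++ [i]).length := by
      simpa using hvt.length_le
    refine ⟨(t ++ [i]).take (v.length + 1), (𝕋.tree T hT).1.mem_of_prefix hi
      (List.take_prefix _ _), huv.trans ?_, List.length_take_of_le hlen⟩
    exact List.prefix_of_prefix_length_le (hvt.trans (List.prefix_append _ _))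
      (List.take_prefix _ _) (by rw [List.length_take_of_le hlen]; omega)

theorem exists_incomparable_splits (hT : T ∈ 𝕋.mem) {u : List ℕ} (hu : u ∈ T) :
    ∃ t₀ t₁, IsSplit T t₀ ∧ IsSplit T t₁ ∧ u <+: t₀ ∧ u <+: t₁ ∧
      ¬ t₀ <+: t₁ ∧ ¬ t₁ <+: t₀ := by
  obtain ⟨s, hus, -, i, j, hij, hi, hj⟩ := 𝕋.split T hT u hu
  obtain ⟨t₀, h₀, hs₀⟩ := 𝕋.split T hT _ hi
  obtain ⟨t₁, h₁, hs₁⟩ := 𝕋.split T hT _ hj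
  have key : ∀ w, s ++ [i] <+: w → s ++ [j] <+: w → False := fun w hiw hjw => by
    have := (List.prefix_of_prefix_length_le hiw hjw (by simp)).eq_of_length (by simp)
    simp [hij] at this
  exact ⟨t₀, t₁, hs₀, hs₁, hus.trans ((List.prefix_append _ _).trans h₀),
    hus.trans ((List.prefix_append _ _).trans h₁), fun h => key _ (h₀.trans h) h₁,
    fun h => key _ h₀ (h₁.trans h)⟩

theorem exists_doublySplits (hT : T ∈ 𝕋.mem) (m : ℕ) : ∃ N, DoublySplits T m N := by
  choose! t₀ t₁ h₀ h₁ hu₀ hu₁ hc₀ hc₁ using fun u (hu : u ∈ T) =>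
    𝕋.exists_incomparable_splits hT hu
  have hfin : {u ∈ T | u.length = m}.Finite :=
    (finite_bSeq_length b m).subset fun u hu => ⟨(𝕋.tree T hT).2 u hu.1, hu.2⟩
  obtain ⟨N, hN⟩ := (hfin.image fun u => (t₀ u).length + (t₁ u).length).bddAbove
  refine ⟨N + 1, fun u hu hm => ⟨t₀ u, t₁ u, h₀ u hu, h₁ u hu, hu₀ u hu, hu₁ u hu, ?_, ?_,
    hc₀ u hu, hc₁ u hu⟩⟩ <;>
  · have : (t₀ u).length + (t₁ u).length ≤ N := hN ⟨u, ⟨hu, hm⟩, rfl⟩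
    omega

/-- A node `τ` can be removed from a condition without changing the levels up to `m` and without
losing all splitting nodes between `m` and the length of `τ`. -/
theorem exists_le_notMem {A : Set (List ℕ)} (hA : A ∈ 𝕋.mem) {m : ℕ} {τ : List ℕ}
    (hds : DoublySplits A m τ.length) :
    ∃ A' ∈ 𝕋.mem, 𝕋.le A' A ∧ τ ∉ A' ∧ (∀ u ∈ A, u.length ≤ m → u ∈ A') ∧
      (∀ v ∈ A', τ.length ≤ v.length →
        ∃ t, IsSplit A' t ∧ t <+: v ∧ m ≤ t.length ∧ t.length < τ.length) ∧
      FullAbove A A' τ.length := by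
  have hex : ∀ u ∈ Lv m A, ∃ t, IsSplit A t ∧ u <+: t ∧ t.length < τ.length ∧ ¬ t <+: τ := by
    rintro u ⟨hu, hm⟩
    obtain ⟨t₀, t₁, h₀, h₁, hu₀, hu₁, hl₀, hl₁, hc₀, hc₁⟩ := hds u hu hm
    by_cases h : t₀ <+: τ
    · refine ⟨t₁, h₁, hu₁, hl₁, fun h' => ?_⟩
      exact (List.prefix_or_prefix_of_prefix h h').elim hc₀ hc₁
    · exact ⟨t₀, h₀, hu₀, hl₀, h⟩
  choose! t hsp hut hlt hnot using hex
  set B : List ℕ → Set (List ℕ) := fun u => restr (restr A u) (t u) with hB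
  have hmemB : ∀ {u w}, u ∈ Lv m A → w ∈ A → t u <+: w → w ∈ B u := fun hu hw h =>
    ⟨⟨hw, Or.inl ((hut _ hu).trans h)⟩, Or.inl h⟩
  have hpreB : ∀ {u w}, w ∈ B u → τ.length ≤ w.length → u ∈ Lv m A → t u <+: w := by
    intro u w hw hl hu
    refine hw.2.resolve_right fun h => ?_
    have := h.length_le
    have := hlt u hu
    omega
  obtain ⟨hmem, hle⟩ := 𝕋.amalg A hA m B fun u hu => by
    obtain ⟨hr, -⟩ := 𝕋.restr_mem A hA u hu.1
    exact 𝕋.restr_mem _ hr (t u) ⟨(hsp u hu).1, Or.inl (hut u hu)⟩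
  have hin : ∀ {u w}, u ∈ Lv m A → w ∈ B u → w ∈ ⋃ u ∈ Lv m A, B u := fun hu hw =>
    Set.mem_biUnion hu hw
  refine ⟨_, hmem, hle, ?_, ?_, ?_, ?_⟩
  · intro h
    obtain ⟨u, hu, hτ⟩ := Set.mem_iUnion₂.1 h
    exact hnot u hu (hpreB hτ le_rfl hu)
  · intro u hu hm
    obtain ⟨v, hv, huv, hvm⟩ := 𝕋.exists_prefix_length_eq hA hu hm
    have hvL : v ∈ Lv m A := ⟨hv, hvm⟩
    exact hin hvL ⟨⟨hu, Or.inr huv⟩, Or.inr (huv.trans (hut v hvL))⟩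
  · intro v hv hl
    obtain ⟨u, hu, hvu⟩ := Set.mem_iUnion₂.1 hv
    obtain ⟨htA, i, j, hij, hi, hj⟩ := hsp u hu
    exact ⟨t u, ⟨hin hu (hmemB hu htA List.prefix_rfl), i, j, hij,
      hin hu (hmemB hu hi (List.prefix_append _ _)),
      hin hu (hmemB hu hj (List.prefix_append _ _))⟩, hpreB hvu hl hu,
      hu.2 ▸ (hut u hu).length_le, hlt u hu⟩
  · intro v hv hl w hw hvw
    obtain ⟨u, hu, hvu⟩ := Set.mem_iUnion₂.1 hv
    exact hin hu (hmemB hu hw ((hpreB hvu hl hu).trans hvw))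

/-- If `T` splits doubly between the levels `m n` and `(τ n).length`, where `(τ n).length ≤ m (n + 1)`, all the
nodes `τ n` can be removed from `T` simultaneously. -/
theorem exists_le_forall_notMem (hT : T ∈ 𝕋.mem) (m : ℕ → ℕ) (τ : ℕ → List ℕ)
    (hmτ : ∀ n, m n ≤ m (n + 1)) (hτm : ∀ n, (τ n).length ≤ m (n + 1))
    (hds : ∀ n, DoublySplits T (m n) (τ n).length) :
    ∃ S ∈ 𝕋.mem, 𝕋.le S T ∧ ∀ n, τ n ∉ S := by
  have step : ∀ n A, (A ∈ 𝕋.mem ∧ A ⊆ T ∧ SplitsOften A (m n) n ∧ FullAbove T A (m n)) →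
      ∃ A', (A' ∈ 𝕋.mem ∧ A' ⊆ T ∧ SplitsOften A' (m (n + 1)) (n + 1) ∧
        FullAbove T A' (m (n + 1))) ∧ 𝕋.le A' A ∧ τ n ∉ A' ∧
        ∀ u ∈ A, u.length ≤ m n → u ∈ A' := by
    rintro n A ⟨hA, hAT, hso, hfull⟩
    obtain ⟨A', hA', hle, hτ, hkeep, hsplit, hfull'⟩ :=
      𝕋.exists_le_notMem hA ((hds n).of_fullAbove hAT hfull)
    have hsub := 𝕋.le_sub A' hA' A hA hle
    refine ⟨A', ⟨hA', hsub.trans hAT, hso.succ hsub (hmτ n) hkeep ?_, ?_⟩, hle, hτ, hkeep⟩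
    · intro v hv hl
      obtain ⟨t, h₁, h₂, h₃, h₄⟩ := hsplit v hv ((hτm n).trans hl)
      exact ⟨t, h₁, h₂, h₃, h₄.trans_le (hτm n)⟩
    · intro v hv hl w hw hvw
      exact hfull' v hv ((hτm n).trans hl) w
        (hfull v (hsub hv) ((hmτ n).trans hl) w hw hvw) hvw
  choose! next hinv hle hτ hkeep using step
  let A : ℕ → Set (List ℕ) := fun n => Nat.rec T next n
  have hA : ∀ n, A n ∈ 𝕋.mem ∧ A n ⊆ T ∧ SplitsOften (A n) (m n) n ∧
      FullAbove T (A n) (m n) := by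
    intro n
    induction n with
    | zero => exact ⟨hT, subset_rfl, fun _ _ _ => Nat.zero_le _, fun _ _ _ w hw _ => hw⟩
    | succ n ih => exact hinv n (A n) ih
  have hAle : ∀ n, 𝕋.le (A (n + 1)) (A n) := fun n => hle n (A n) (hA n)
  obtain ⟨hS, hSle⟩ := 𝕋.fusion (fun n => A (n + 1)) (fun n => (hA (n + 1)).1)
    (fun n => hAle (n + 1)) fun n => by
      have hsub := 𝕋.le_sub _ (hA (n + 2)).1 _ (hA (n + 1)).1 (hAle (n + 1))
      exact ⟨hsub, m (n + 1), fun s hs => (hA (n + 1)).2.2.1.length_lt hs,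
        fun u hu => ⟨fun h => hsub h, fun h => hkeep (n + 1) _ (hA (n + 1)) u h hu.le⟩⟩
  refine ⟨_, hS, 𝕋.le_trans _ hS _ (hA 1).1 _ hT (hSle 0) (hAle 0), fun n h => ?_⟩
  exact hτ n (A n) (hA n) (Set.mem_iInter.1 h n)

end BTreeForcing

/-- Main Lemma: Let `𝕋` be a `b`-tree forcing notion, `D` a dominating family of
increasing functions, and for each `f ∈ D` let `σ f : ℕ → seq(b)` satisfy
`|σ f n| = f* n` for all `n`. Then for every `T ∈ 𝕋` there are `S ∈ 𝕋` with
`S ≤ T` and `f ∈ D` such that `[σ f]_∞ ∩ [S] = ∅`. -/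
theorem stmt0 (b : ℕ → ℕ) (hb : ∀ i, 1 ≤ b i) (𝕋 : BTreeForcing b)
    (D : Set (ℕ → ℕ)) (hdom : ∀ g : ℕ → ℕ, ∃ f ∈ D, LeStar g f)
    (hinc : ∀ f ∈ D, StrictMono f)
    (σ : (ℕ → ℕ) → ℕ → List ℕ)
    (hσ : ∀ f ∈ D, ∀ n, IsBSeq b (σ f n) ∧ (σ f n).length = fstar f n)
    (T : Set (List ℕ)) (hT : T ∈ 𝕋.mem) :
    ∃ S ∈ 𝕋.mem, 𝕋.le S T ∧ ∃ f ∈ D, limsupCyl b (σ f) ∩ branches S = ∅ := by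
  choose g hg using 𝕋.exists_doublySplits hT
  obtain ⟨f, hfD, hgf⟩ := hdom g
  obtain ⟨M, hM⟩ := Filter.eventually_atTop.1 hgf
  have hf := hinc f hfD
  have hlen : ∀ n, (σ f n).length = fstar f n := fun n => (hσ f hfD n).2
  obtain ⟨S, hS, hST, hnot⟩ := 𝕋.exists_le_forall_notMem hT (fun n => fstar f (M + n) + 1)
    (fun n => σ f (M + n + 1))
    (fun n => by
      have := hf.id_le (fstar f (M + n) + 1)
      change fstar f (M + n) + 1 ≤ f (fstar f (M + n) + 1) + 1
      simp only [id] at this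
      omega)
    (fun n => (hlen _).le.trans (Nat.le_succ _))
    (fun n => by
      rw [hlen]
      refine (hg _).mono (hM _ ?_)
      have := le_fstar hf (M + n)
      omega)
  refine ⟨S, hS, hST, f, hfD, Set.eq_empty_iff_forall_notMem.2 ?_⟩
  rintro x ⟨⟨-, hx⟩, hxS⟩
  obtain ⟨n, hn, hinit⟩ := hx (M + 1)
  obtain ⟨k, rfl⟩ := Nat.exists_eq_add_of_le hn
  have hmem := hxS (σ f (M + 1 + k)).length
  have heq : (List.ofFn fun i : Fin (σ f (M + 1 + k)).length => x i) = σ f (M + 1 + k) := by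
    rw [← funext hinit]
    exact List.ofFn_get _
  rw [heq, Nat.add_right_comm] at hmem
  exact hnot k hmem
end

section
/- For every interval partition I of ω and every increasing function f ∈ ω^ω, if f_I ≤* f then I ⊑ I^f. -/
/-- `p` determines an interval partition of `ω`: it is the strictly increasing
function `f_I` with `f_I 0 = 0` whose blocks are `I_n = [p n, p (n+1))`. -/
def IsIP (p : ℕ → ℕ) : Prop := StrictMono p ∧ p 0 = 0

/-- The `n`-th block of the interval partition determined by `p`. -/
def blk (p : ℕ → ℕ) (n : ℕ) : Set ℕ := Set.Ico (p n) (p (n + 1))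

/-- `I ⊑ J`: for all but finitely many `n` there is `m` with `I_m ⊆ J_n`. -/
def Sq (p q : ℕ → ℕ) : Prop := ∀ᶠ n in Filter.atTop, ∃ m, blk p m ⊆ blk q n

/-- For every interval partition `I` (determined by `p`) and every increasing
function `f`, if `f_I ≤* f` then `I ⊑ I^f` (where `I^f` is determined by `f*`). -/
theorem stmt4 (p : ℕ → ℕ) (hp : IsIP p) (f : ℕ → ℕ) (hf : StrictMono f)
    (h : LeStar p f) : Sq p (fstar f) := by
  have hq : ∀ n, n ≤ fstar f n := by
    intro n
    induction n with
    | zero => exact Nat.zero_le _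
    | succ n ih => exact (Nat.succ_le_succ ih).trans hf.le_apply
  obtain ⟨N, hN⟩ := Filter.eventually_atTop.1 h
  refine Filter.eventually_atTop.2 ⟨N, fun n hn => ⟨fstar f n, ?_⟩⟩
  exact Set.Ico_subset_Ico hp.1.le_apply
    (hN _ ((hn.trans (hq n)).trans (Nat.le_succ _)))
end

section
/- For every increasing function f ∈ ω^ω and every interval partition I of ω, if I^f ⋫ I then f ≤* f_I. -/
/-- `I ⋫ J`: for all but finitely many `n` there is no `m` with `J_m ⊆ I_n`. -/
def NTr (p q : ℕ → ℕ) : Prop := ∀ᶠ n in Filter.atTop, ∀ m, ¬ blk q m ⊆ blk p n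

/-- If `f` moves some `K ≤ N`, then `f*` grows by at least two at each step from `N` on. -/
theorem two_mul_le_fstar_add {f : ℕ → ℕ} (hf : StrictMono f) {K N : ℕ} (hK : K < f K)
    (hKN : K ≤ N) (j : ℕ) : 2 * j ≤ fstar f (N + j) := by
  induction j with
  | zero => exact Nat.zero_le _
  | succ j ih =>
    have hle := le_fstar hf (N + j)
    have hadd := hf.add_le_nat (fstar f (N + j) + 1 - K) K
    rw [Nat.sub_add_cancel (by omega)] at hadd
    change 2 * (j + 1) ≤ f (fstar f (N + j) + 1)
    omega

/-- If no block of `p` lies in a block of `q` from the `N`-th on, then `p` eventually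
runs ahead of `q`, up to a shift. -/
theorem le_apply_add_of_not_blk_subset {p q : ℕ → ℕ} {N k₀ : ℕ}
    (h : ∀ n ≥ N, ∀ m, ¬ blk p m ⊆ blk q n) (h₀ : q N ≤ p k₀) (i : ℕ) :
    q (N + i) ≤ p (k₀ + i) := by
  induction i with
  | zero => exact h₀
  | succ i ih =>
    by_contra! hlt
    exact h (N + i) (Nat.le_add_right _ _) (k₀ + i) (Set.Ico_subset_Ico ih hlt.le)

/-- For every increasing `f` and every interval partition `I` (determined by `p`,
so `f_I = p`), if `I^f ⋫ I` then `f ≤* f_I` (where `I^f` is determined by `f*`). -/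
theorem stmt6 (f p : ℕ → ℕ) (hf : StrictMono f) (hp : IsIP p)
    (h : NTr (fstar f) p) : LeStar f p := by
  by_cases hid : ∀ k, f k ≤ k
  · exact Filter.Eventually.of_forall fun k => (hid k).trans hp.1.le_apply
  push Not at hid
  obtain ⟨K, hK⟩ := hid
  obtain ⟨M, hM⟩ := Filter.eventually_atTop.1 h
  obtain ⟨N, hKN, hMN⟩ : ∃ N, K ≤ N ∧ M ≤ N := ⟨_, le_max_left K M, le_max_right K M⟩
  have hq := le_apply_add_of_not_blk_subset
    (fun n hn => hM n (hMN.trans hn)) (hp.1.le_apply (x := fstar f N))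
  refine Filter.eventually_atTop.2 ⟨2 * fstar f N + 1, fun k hk => ?_⟩
  obtain ⟨j, rfl⟩ : ∃ j, k = fstar f N + (j + 1) := ⟨k - fstar f N - 1, by omega⟩
  have h2 := two_mul_le_fstar_add hf hK hKN j
  exact (hf.monotone (by omega : _ ≤ fstar f (N + j) + 1)).trans (hq (j + 1))
end

section
/- If D ⊆ ω^ω is a dominating family consisting of increasing functions, then {I^f : f ∈ D} is dominating with respect to ⊑: for every interval partition I of ω there is f ∈ D with I ⊑ I^f. -/
theorem fstar_strictMono {f : ℕ → ℕ} (hf : StrictMono f) : StrictMono (fstar f) :=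
  strictMono_nat_of_lt_succ fun n => Nat.lt_of_succ_le (hf.le_apply (x := fstar f n + 1))

/-- If `D ⊆ ω^ω` is a dominating family consisting of increasing functions, then
`{I^f : f ∈ D}` is dominating with respect to `⊑`: for every interval partition `I`
(determined by `p`) there is `f ∈ D` with `I ⊑ I^f` (where `I^f` is determined by `f*`). -/
theorem stmt7 (D : Set (ℕ → ℕ)) (hdom : ∀ g : ℕ → ℕ, ∃ f ∈ D, LeStar g f)
    (hinc : ∀ f ∈ D, StrictMono f) (p : ℕ → ℕ) (hp : IsIP p) :
    ∃ f ∈ D, Sq p (fstar f) := by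
  obtain ⟨f, hfD, hpf⟩ := hdom p
  have hf := hinc f hfD
  refine ⟨f, hfD, ?_⟩
  have htop : Filter.Tendsto (fun n => fstar f n + 1) Filter.atTop Filter.atTop :=
    (Filter.tendsto_add_atTop_nat 1).comp (fstar_strictMono hf).tendsto_atTop
  filter_upwards [htop.eventually hpf] with n hn
  exact ⟨fstar f n, Set.Ico_subset_Ico hp.1.le_apply hn⟩
end

section
/- The least cardinality of a family 𝒟 of interval partitions of ω such that every interval partition I satisfies I ⊑ J for some J ∈ 𝒟 equals the dominating number 𝔡, and the least cardinality of a family 𝒟 of interval partitions such that every interval partition I satisfies I ⋫ J for some J ∈ 𝒟 also equals 𝔡. Dually, the least cardinality of a family 𝒰 of interval partitions such that no single interval partition J satisfies I ⊑ J for all I ∈ 𝒰 equals the bounding number 𝔟, and the same holds with ⋫ in place of ⊑. -/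
open Cardinal

/-- The type of interval partitions of `ω`. -/
def IP : Type := {p : ℕ → ℕ // IsIP p}

/-- The dominating number `𝔡`. -/
noncomputable def dNumber : Cardinal :=
  sInf {c | ∃ D : Set (ℕ → ℕ), (∀ g : ℕ → ℕ, ∃ f ∈ D, LeStar g f) ∧ c = #D}

/-- The bounding number `𝔟`. -/
noncomputable def bNumber : Cardinal :=
  sInf {c | ∃ B : Set (ℕ → ℕ), (¬ ∃ g : ℕ → ℕ, ∀ f ∈ B, LeStar f g) ∧ c = #B}

/-- `R` is Tukey reducible to `S`: there is a Galois–Tukey connection from `R` to `S`. -/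
def TukeyLE {X Y X' Y' : Type} (R : X → Y → Prop) (S : X' → Y' → Prop) : Prop :=
  ∃ (φ : X → X') (ψ : Y' → Y), ∀ x y, S (φ x) y → R x (ψ y)

theorem TukeyLE.trans {X Y X' Y' X'' Y'' : Type} {R : X → Y → Prop} {S : X' → Y' → Prop}
    {T : X'' → Y'' → Prop} (h₁ : TukeyLE R S) (h₂ : TukeyLE S T) : TukeyLE R T := by
  obtain ⟨φ, ψ, h⟩ := h₁
  obtain ⟨φ', ψ', h'⟩ := h₂
  exact ⟨φ' ∘ φ, ψ ∘ ψ', fun x y hxy => h _ _ (h' _ _ hxy)⟩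

/-- The cardinalities of the dominating families of a relation. -/
def dominatingCards {X Y : Type} (R : X → Y → Prop) : Set Cardinal.{0} :=
  {c | ∃ D : Set Y, (∀ x, ∃ y ∈ D, R x y) ∧ c = #D}

/-- The cardinalities of the unbounded families of a relation. -/
def unboundedCards {X Y : Type} (R : X → Y → Prop) : Set Cardinal.{0} :=
  {c | ∃ U : Set X, (¬ ∃ y, ∀ x ∈ U, R x y) ∧ c = #U}

theorem Cardinal.sInf_eq_of_coinitial {A B : Set Cardinal.{0}}
    (hAB : ∀ a ∈ A, ∃ b ∈ B, b ≤ a) (hBA : ∀ b ∈ B, ∃ a ∈ A, a ≤ b) : sInf A = sInf B := by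
  rcases A.eq_empty_or_nonempty with rfl | hA
  · rcases B.eq_empty_or_nonempty with rfl | ⟨b, hb⟩
    · rfl
    · obtain ⟨a, ha, -⟩ := hBA b hb
      exact absurd ha (Set.notMem_empty a)
  · obtain ⟨b, hb, hbA⟩ := hAB _ (csInf_mem hA)
    obtain ⟨a, ha, haB⟩ := hBA _ (csInf_mem ⟨b, hb⟩)
    exact le_antisymm ((csInf_le' ha).trans haB) ((csInf_le' hb).trans hbA)

namespace TukeyLE

variable {X Y X' Y' : Type} {R : X → Y → Prop} {S : X' → Y' → Prop}

theorem exists_dominatingCards_le (h : TukeyLE R S) :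
    ∀ c ∈ dominatingCards S, ∃ d ∈ dominatingCards R, d ≤ c := by
  obtain ⟨φ, ψ, h⟩ := h
  rintro _ ⟨D, hD, rfl⟩
  refine ⟨_, ⟨ψ '' D, fun x => ?_, rfl⟩, mk_image_le⟩
  obtain ⟨y, hy, hxy⟩ := hD (φ x)
  exact ⟨ψ y, Set.mem_image_of_mem ψ hy, h _ _ hxy⟩

theorem exists_unboundedCards_le (h : TukeyLE R S) :
    ∀ c ∈ unboundedCards R, ∃ d ∈ unboundedCards S, d ≤ c := by
  obtain ⟨φ, ψ, h⟩ := h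
  rintro _ ⟨U, hU, rfl⟩
  refine ⟨_, ⟨φ '' U, ?_, rfl⟩, mk_image_le⟩
  rintro ⟨y, hy⟩
  exact hU ⟨ψ y, fun x hx => h _ _ (hy _ (Set.mem_image_of_mem φ hx))⟩

theorem sInf_dominatingCards_eq (h : TukeyLE R S) (h' : TukeyLE S R) :
    sInf (dominatingCards R) = sInf (dominatingCards S) :=
  sInf_eq_of_coinitial h'.exists_dominatingCards_le h.exists_dominatingCards_le

theorem sInf_unboundedCards_eq (h : TukeyLE R S) (h' : TukeyLE S R) :
    sInf (unboundedCards R) = sInf (unboundedCards S) :=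
  sInf_eq_of_coinitial h.exists_unboundedCards_le h'.exists_unboundedCards_le

end TukeyLE

/-- The interval partition whose successive endpoints are obtained from `0` by repeatedly
passing from `x` to `max (f x) (x + 1)`. -/
def IP.iterate (f : ℕ → ℕ) : IP :=
  ⟨fun k => (fun x => max (f x) (x + 1))^[k] 0, strictMono_nat_of_lt_succ fun k => by
    rw [Function.iterate_succ_apply']
    exact lt_of_lt_of_le (Nat.lt_succ_self _) (le_max_right _ _), rfl⟩

theorem IP.le_iterate_succ (f : ℕ → ℕ) (k : ℕ) :
    f ((IP.iterate f).1 k) ≤ (IP.iterate f).1 (k + 1) := by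
  simp only [IP.iterate, Function.iterate_succ_apply']
  exact le_max_left _ _

/-- The interval partition obtained by merging consecutive pairs of blocks. -/
def IP.merge (J : IP) : IP :=
  ⟨fun n => J.1 (2 * n), fun _ _ h => J.2.1 (by omega), J.2.2⟩

theorem blk_subset_blk_iff {p q : ℕ → ℕ} (hp : StrictMono p) (m n : ℕ) :
    blk p m ⊆ blk q n ↔ q n ≤ p m ∧ p (m + 1) ≤ q (n + 1) :=
  Set.Ico_subset_Ico_iff (hp (Nat.lt_succ_self m))

theorem IP.exists_block_mem (I : IP) (n : ℕ) : ∃ k, I.1 k ≤ n ∧ n < I.1 (k + 1) := by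
  refine ⟨Nat.findGreatest (fun k => I.1 k ≤ n) n, ?_, ?_⟩
  · exact Nat.findGreatest_spec (P := fun k => I.1 k ≤ n) (Nat.zero_le n)
      (I.2.2.le.trans (Nat.zero_le n))
  · by_contra! h
    have := Nat.le_findGreatest (P := fun k => I.1 k ≤ n) ((I.2.1.le_apply).trans h) h
    omega

theorem tukeyLE_nTr_sq :
    TukeyLE (fun I J : IP => NTr I.1 J.1) (fun I J : IP => Sq I.1 J.1) := by
  refine ⟨id, IP.merge, fun I J h => ?_⟩
  obtain ⟨N, hN⟩ := Filter.eventually_atTop.1 h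
  refine Filter.eventually_atTop.2 ⟨J.1 (2 * N) + 1, fun n hn m hm => ?_⟩
  rw [blk_subset_blk_iff J.merge.2.1] at hm
  change I.1 n ≤ J.1 (2 * m) ∧ J.1 (2 * m + 2) ≤ I.1 (n + 1) at hm
  have hlt : J.1 (2 * N) < J.1 (2 * m) := by
    have := I.2.1.le_apply (x := n)
    omega
  have hNm := J.2.1.lt_iff_lt.1 hlt
  obtain ⟨k, hk⟩ := hN (2 * m) (by omega)
  rw [id, blk_subset_blk_iff I.2.1] at hk
  have h₁ : n ≤ k := I.2.1.le_iff_le.1 (hm.1.trans hk.1)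
  have h₂ : I.1 (n + 1) ≤ I.1 (k + 1) := I.2.1.monotone (by omega)
  have h₃ : J.1 (2 * m + 1) < J.1 (2 * m + 2) := J.2.1 (Nat.lt_succ_self _)
  omega

theorem tukeyLE_sq_leStar : TukeyLE (fun I J : IP => Sq I.1 J.1) LeStar := by
  refine ⟨fun I n => I.1 (n + 1), IP.iterate, fun I f h => ?_⟩
  obtain ⟨N, hN⟩ := Filter.eventually_atTop.1 h
  refine Filter.eventually_atTop.2 ⟨N, fun n hn => ⟨(IP.iterate f).1 n, ?_⟩⟩
  rw [blk_subset_blk_iff I.2.1]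
  exact ⟨I.2.1.le_apply, (hN _ (hn.trans (IP.iterate f).2.1.le_apply)).trans
    (IP.le_iterate_succ f n)⟩

theorem tukeyLE_leStar_nTr : TukeyLE LeStar (fun I J : IP => NTr I.1 J.1) := by
  refine ⟨fun g => IP.iterate fun x => ∑ i ∈ Finset.range (x + 1), g i,
    fun J n => J.1 (n + 2), fun g J h => ?_⟩
  set I := IP.iterate fun x => ∑ i ∈ Finset.range (x + 1), g i
  obtain ⟨N, hN⟩ := Filter.eventually_atTop.1 h
  refine Filter.eventually_atTop.2 ⟨I.1 N, fun n hn => ?_⟩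
  by_contra! hlt
  obtain ⟨k, hk, hk'⟩ := I.exists_block_mem n
  have hNk : N ≤ k := Nat.lt_succ_iff.1 (I.2.1.lt_iff_lt.1 (hn.trans_lt hk'))
  have hg : g n ≤ I.1 (k + 2) :=
    (Finset.single_le_sum (f := g) (fun _ _ => Nat.zero_le _)
      (Finset.mem_range.2 (hk'.trans (Nat.lt_succ_self _)))).trans
      (IP.le_iterate_succ (fun x => ∑ i ∈ Finset.range (x + 1), g i) (k + 1))
  have hJ : n ≤ J.1 n := J.2.1.le_apply
  rcases le_total (J.1 (n + 1)) (I.1 (k + 1)) with hle | hle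
  · exact hN k hNk n ((blk_subset_blk_iff J.2.1 _ _).2 ⟨hk.trans hJ, hle⟩)
  · exact hN (k + 1) (by omega) (n + 1)
      ((blk_subset_blk_iff J.2.1 _ _).2 ⟨hle, hlt.le.trans hg⟩)

/-- The least size of a family of interval partitions dominating w.r.t. `⊑` is `𝔡`;
the least size of a family dominating w.r.t. `⋫` is `𝔡`; the least size of a family
unbounded w.r.t. `⊑` is `𝔟`; and the least size of a family unbounded w.r.t. `⋫` is `𝔟`. -/
theorem stmt8 :
    sInf {c | ∃ 𝒟 : Set IP, (∀ I : IP, ∃ J ∈ 𝒟, Sq I.1 J.1) ∧ c = #𝒟} = dNumber ∧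
    sInf {c | ∃ 𝒟 : Set IP, (∀ I : IP, ∃ J ∈ 𝒟, NTr I.1 J.1) ∧ c = #𝒟} = dNumber ∧
    sInf {c | ∃ 𝒰 : Set IP, (¬ ∃ J : IP, ∀ I ∈ 𝒰, Sq I.1 J.1) ∧ c = #𝒰} = bNumber ∧
    sInf {c | ∃ 𝒰 : Set IP, (¬ ∃ J : IP, ∀ I ∈ 𝒰, NTr I.1 J.1) ∧ c = #𝒰} = bNumber := by
  have leStar_sq := tukeyLE_leStar_nTr.trans tukeyLE_nTr_sq
  have nTr_leStar := tukeyLE_nTr_sq.trans tukeyLE_sq_leStar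
  exact ⟨tukeyLE_sq_leStar.sInf_dominatingCards_eq leStar_sq,
    nTr_leStar.sInf_dominatingCards_eq tukeyLE_leStar_nTr,
    tukeyLE_sq_leStar.sInf_unboundedCards_eq leStar_sq,
    nTr_leStar.sInf_unboundedCards_eq tukeyLE_leStar_nTr⟩
end

section
/- Let b : ℕ → ℕ with b(i) ≥ 1 for all i, let X ⊆ ∏b, and let D ⊆ ω^ω be a dominating family. Then X has strong measure zero iff for every f ∈ D there is σ : ℕ → seq(b) with |σ(n)| = f(n) for all n such that X ⊆ [σ]_∞. -/
/-- `[s]`: the set of `x ∈ ∏b` with initial segment `s`. -/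
def cyl (b : ℕ → ℕ) (s : List ℕ) : Set (ℕ → ℕ) := {x ∈ prodSet b | IsInit s x}

/-- `X ⊆ ∏b` has strong measure zero: for every `f : ℕ → ℕ` there is
`σ : ℕ → seq(b)` with `|σ n| = f n` for all `n` such that `X ⊆ ⋃ n, [σ n]`. -/
def SMZb (b : ℕ → ℕ) (X : Set (ℕ → ℕ)) : Prop :=
  ∀ f : ℕ → ℕ, ∃ σ : ℕ → List ℕ,
    (∀ n, IsBSeq b (σ n) ∧ (σ n).length = f n) ∧ X ⊆ ⋃ n, cyl b (σ n)

theorem IsBSeq.take {b : ℕ → ℕ} {s : List ℕ} (h : IsBSeq b s) (k : ℕ) :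
    IsBSeq b (s.take k) := by
  intro i
  have hi : (i : ℕ) < s.length := i.isLt.trans_le (List.length_take_le' k s)
  simpa using h ⟨i, hi⟩

theorem IsInit.take {s : List ℕ} {x : ℕ → ℕ} (h : IsInit s x) (k : ℕ) :
    IsInit (s.take k) x := by
  intro i
  have hi : (i : ℕ) < s.length := i.isLt.trans_le (List.length_take_le' k s)
  simpa using h ⟨i, hi⟩

theorem isBSeq_replicate_zero {b : ℕ → ℕ} (hb : ∀ i, 1 ≤ b i) (k : ℕ) :
    IsBSeq b (List.replicate k 0) := by
  intro i
  simpa using Nat.lt_of_succ_le (hb i)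

/-- A strong measure zero set is covered infinitely often by cylinders of any prescribed
lengths. -/
theorem SMZb.exists_subset_limsupCyl {b : ℕ → ℕ} {X : Set (ℕ → ℕ)} (h : SMZb b X)
    (hX : X ⊆ prodSet b) (f : ℕ → ℕ) :
    ∃ σ : ℕ → List ℕ,
      (∀ n, IsBSeq b (σ n) ∧ (σ n).length = f n) ∧ X ⊆ limsupCyl b σ := by
  choose τ hτ hcov using fun k => h fun j => f (Nat.pair k j)
  refine ⟨fun n => τ n.unpair.1 n.unpair.2, fun n => ?_, fun x hx => ⟨hX hx, fun m => ?_⟩⟩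
  · simpa using hτ n.unpair.1 n.unpair.2
  · obtain ⟨j, hj⟩ := Set.mem_iUnion.1 (hcov m hx)
    exact ⟨Nat.pair m j, Nat.left_le_pair m j, by simpa using hj.2⟩

/-- If cylinders of lengths `f n` cover `X` infinitely often and `g ≤* f`, then cylinders of
lengths `g n` cover `X`. -/
theorem exists_subset_iUnion_cyl_of_leStar {b : ℕ → ℕ} (hb : ∀ i, 1 ≤ b i)
    {X : Set (ℕ → ℕ)} {f g : ℕ → ℕ} (hgf : LeStar g f) {σ : ℕ → List ℕ}
    (hσ : ∀ n, IsBSeq b (σ n) ∧ (σ n).length = f n) (hXσ : X ⊆ limsupCyl b σ) :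
    ∃ τ : ℕ → List ℕ,
      (∀ n, IsBSeq b (τ n) ∧ (τ n).length = g n) ∧ X ⊆ ⋃ n, cyl b (τ n) := by
  refine ⟨fun n => if g n ≤ f n then (σ n).take (g n) else List.replicate (g n) 0,
    fun n => ?_, fun x hx => ?_⟩
  · by_cases h : g n ≤ f n
    · simpa [h, (hσ n).2] using (hσ n).1.take (g n)
    · simpa [h] using isBSeq_replicate_zero hb (g n)
  · obtain ⟨N, hN⟩ := Filter.eventually_atTop.1 hgf
    obtain ⟨hxb, hinf⟩ := hXσ hx
    obtain ⟨n, hn, hinit⟩ := hinf N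
    refine Set.mem_iUnion.2 ⟨n, hxb, ?_⟩
    simpa [hN n hn] using hinit.take (g n)

/-- Characterization of strong measure zero in `∏b` in terms of a dominating
family `D`: `X` has strong measure zero iff for every `f ∈ D` there is `σ` with
`|σ n| = f n` for all `n` such that `X ⊆ [σ]_∞`. -/
theorem stmt9 (b : ℕ → ℕ) (hb : ∀ i, 1 ≤ b i) (X : Set (ℕ → ℕ))
    (hX : X ⊆ prodSet b) (D : Set (ℕ → ℕ)) (hD : ∀ g : ℕ → ℕ, ∃ f ∈ D, LeStar g f) :
    SMZb b X ↔ ∀ f ∈ D, ∃ σ : ℕ → List ℕ,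
      (∀ n, IsBSeq b (σ n) ∧ (σ n).length = f n) ∧ X ⊆ limsupCyl b σ := by
  refine ⟨fun h f _ => h.exists_subset_limsupCyl hX f, fun h g => ?_⟩
  obtain ⟨f, hfD, hgf⟩ := hD g
  obtain ⟨σ, hσ, hXσ⟩ := h f hfD
  exact exists_subset_iUnion_cyl_of_leStar hb hgf hσ hXσ
end

section
/- Let b : ℕ → ℕ with b(i) ≥ 1 for all i and b(i) ≥ 2 for infinitely many i, and let F_b : ∏b → [0,1] be defined by F_b(x) = Σ_{n<ω} x(n)/∏_{i≤n} b(i). Then for every X ⊆ ∏b, X has strong measure zero in ∏b iff the image F_b[X] has strong measure zero in [0,1]; and for every Y ⊆ [0,1], Y has strong measure zero in [0,1] iff the preimage F_b^{-1}(Y) has strong measure zero in ∏b. -/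
/-- `Y ⊆ [0,1]` has strong measure zero: for every sequence `ε` of positive reals
there is a sequence of intervals, the `n`-th of length at most `ε n`, covering `Y`. -/
def SMZReal (Y : Set ℝ) : Prop :=
  ∀ ε : ℕ → ℝ, (∀ n, 0 < ε n) →
    ∃ a c : ℕ → ℝ, (∀ n, c n - a n ≤ ε n) ∧ Y ⊆ ⋃ n, Set.Icc (a n) (c n)

/-- `F_b x = Σ_{n<ω} x n / ∏_{i ≤ n} b i`. -/
noncomputable def Fb (b : ℕ → ℕ) (x : ℕ → ℕ) : ℝ :=
  ∑' n : ℕ, (x n : ℝ) / ∏ i ∈ Finset.range (n + 1), (b i : ℝ)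

/-- The product of the first `n` bases. -/
def basePow (b : ℕ → ℕ) (n : ℕ) : ℕ := ∏ i ∈ Finset.range n, b i

/-- The integer with mixed-radix digits `x 0, …, x (n - 1)` in the bases `b 0, …, b (n - 1)`,
most significant digit first. -/
def prefixCode (b x : ℕ → ℕ) : ℕ → ℕ
  | 0 => 0
  | n + 1 => prefixCode b x n * b n + x n

/-- The remainders of the greedy expansion of `y` in the bases `b 0, b 1, …`. -/
noncomputable def greedyRem (b : ℕ → ℕ) (y : ℝ) : ℕ → ℝ
  | 0 => y
  | n + 1 => greedyRem b y n * b n - (min ⌊greedyRem b y n * b n⌋₊ (b n - 1) : ℕ)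

/-- The digits of the greedy expansion of `y` in the bases `b 0, b 1, …`. -/
noncomputable def greedyDigit (b : ℕ → ℕ) (y : ℝ) (n : ℕ) : ℕ :=
  min ⌊greedyRem b y n * b n⌋₊ (b n - 1)

section

variable {b : ℕ → ℕ}

theorem basePow_succ (b : ℕ → ℕ) (n : ℕ) : basePow b (n + 1) = basePow b n * b n :=
  Finset.prod_range_succ _ _

theorem basePow_pos (hb1 : ∀ i, 1 ≤ b i) (n : ℕ) : 0 < basePow b n :=
  Finset.prod_pos fun i _ => hb1 i

theorem basePow_mono (hb1 : ∀ i, 1 ≤ b i) : Monotone (basePow b) :=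
  monotone_nat_of_le_succ fun n => by
    rw [basePow_succ]
    exact Nat.le_mul_of_pos_right _ (hb1 n)

theorem exists_le_basePow (hb1 : ∀ i, 1 ≤ b i) (hb2 : ∀ m, ∃ i ≥ m, 2 ≤ b i) (K : ℕ) :
    ∃ n, K ≤ basePow b n := by
  induction K with
  | zero => exact ⟨0, Nat.zero_le _⟩
  | succ K ih =>
    obtain ⟨n, hn⟩ := ih
    obtain ⟨i, hi, h2⟩ := hb2 n
    refine ⟨i + 1, ?_⟩
    have h := basePow_mono hb1 hi
    have hpos := basePow_pos hb1 i
    rw [basePow_succ]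
    nlinarith

theorem tendsto_basePow (hb1 : ∀ i, 1 ≤ b i) (hb2 : ∀ m, ∃ i ≥ m, 2 ≤ b i) :
    Filter.Tendsto (fun n => (basePow b n : ℝ)) Filter.atTop Filter.atTop :=
  tendsto_natCast_atTop_atTop.comp
    (Filter.tendsto_atTop_atTop_of_monotone (basePow_mono hb1) (exists_le_basePow hb1 hb2))

theorem sum_range_eq_prefixCode_div (hb1 : ∀ i, 1 ≤ b i) (x : ℕ → ℕ) (n : ℕ) :
    ∑ k ∈ Finset.range n, (x k : ℝ) / ∏ i ∈ Finset.range (k + 1), (b i : ℝ) =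
      prefixCode b x n / basePow b n := by
  induction n with
  | zero => simp [prefixCode]
  | succ n ih =>
    have h : (∏ i ∈ Finset.range (n + 1), (b i : ℝ)) = basePow b n * b n := by
      rw [← Nat.cast_mul, ← basePow_succ, basePow, Nat.cast_prod]
    have h0 : (basePow b n : ℝ) ≠ 0 := by exact_mod_cast (basePow_pos hb1 n).ne'
    have h1 : (b n : ℝ) ≠ 0 := by exact_mod_cast Nat.pos_iff_ne_zero.mp (hb1 n)
    rw [Finset.sum_range_succ, ih, h, basePow_succ, prefixCode]
    push_cast
    field_simp

theorem prefixCode_div_add_antitone (hb1 : ∀ i, 1 ≤ b i) {x : ℕ → ℕ} (hx : x ∈ prodSet b) :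
    Antitone fun n => ((prefixCode b x n : ℝ) + 1) / basePow b n := by
  refine antitone_nat_of_succ_le fun n => ?_
  have h0 : (0 : ℝ) < basePow b n := by exact_mod_cast basePow_pos hb1 n
  have h1 : (0 : ℝ) < b n := by exact_mod_cast hb1 n
  have h2 : (x n : ℝ) + 1 ≤ b n := by exact_mod_cast hx n
  rw [basePow_succ, prefixCode, Nat.cast_mul, div_le_div_iff₀ (by positivity) h0]
  push_cast
  nlinarith

theorem prefixCode_div_le (hb1 : ∀ i, 1 ≤ b i) {x : ℕ → ℕ} (hx : x ∈ prodSet b) {m n : ℕ}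
    (h : m ≤ n) :
    (prefixCode b x n : ℝ) / basePow b n ≤ ((prefixCode b x m : ℝ) + 1) / basePow b m := by
  refine le_trans ?_ (prefixCode_div_add_antitone hb1 hx h)
  exact div_le_div_of_nonneg_right (le_add_of_nonneg_right zero_le_one) (Nat.cast_nonneg _)

theorem summable_Fb (hb1 : ∀ i, 1 ≤ b i) {x : ℕ → ℕ} (hx : x ∈ prodSet b) :
    Summable fun n => (x n : ℝ) / ∏ i ∈ Finset.range (n + 1), (b i : ℝ) := by
  refine summable_of_sum_range_le (c := 1) (fun n => by positivity) fun n => ?_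
  rw [sum_range_eq_prefixCode_div hb1]
  simpa [prefixCode, basePow] using prefixCode_div_le hb1 hx (Nat.zero_le n)

theorem prefixCode_div_le_Fb (hb1 : ∀ i, 1 ≤ b i) {x : ℕ → ℕ} (hx : x ∈ prodSet b) (n : ℕ) :
    (prefixCode b x n : ℝ) / basePow b n ≤ Fb b x := by
  rw [← sum_range_eq_prefixCode_div hb1]
  exact (summable_Fb hb1 hx).sum_le_tsum _ fun i _ => by positivity

theorem Fb_le_prefixCode_add_one_div (hb1 : ∀ i, 1 ≤ b i) {x : ℕ → ℕ} (hx : x ∈ prodSet b)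
    (n : ℕ) : Fb b x ≤ ((prefixCode b x n : ℝ) + 1) / basePow b n := by
  refine le_of_tendsto (summable_Fb hb1 hx).hasSum.tendsto_sum_nat ?_
  filter_upwards [Filter.eventually_ge_atTop n] with m hm
  rw [sum_range_eq_prefixCode_div hb1]
  exact prefixCode_div_le hb1 hx hm

theorem prefixCode_congr {x y : ℕ → ℕ} {n : ℕ} (h : ∀ i < n, x i = y i) :
    prefixCode b x n = prefixCode b y n := by
  induction n with
  | zero => rfl
  | succ n ih => rw [prefixCode, prefixCode, ih fun i hi => h i (hi.trans n.lt_succ_self),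
      h n n.lt_succ_self]

theorem eq_of_prefixCode_eq {x y : ℕ → ℕ} (hx : x ∈ prodSet b) (hy : y ∈ prodSet b) {n : ℕ}
    (h : prefixCode b x n = prefixCode b y n) : ∀ i < n, x i = y i := by
  induction n with
  | zero => simp
  | succ n ih =>
    have hxn := hx n
    have hyn := hy n
    have hmod := congrArg (· % b n) h
    have hdiv := congrArg (· / b n) h
    simp only [prefixCode, Nat.mul_add_mod_self_right, Nat.mod_eq_of_lt hxn,
      Nat.mod_eq_of_lt hyn] at hmod
    have hpos : 0 < b n := by omega
    simp only [prefixCode, mul_comm _ (b n), Nat.mul_add_div hpos, Nat.div_eq_of_lt hxn,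
      Nat.div_eq_of_lt hyn, add_zero] at hdiv
    intro i hi
    rcases Nat.lt_succ_iff_lt_or_eq.mp hi with hi | rfl
    · exact ih hdiv i hi
    · exact hmod

theorem greedyRem_mem_Icc (hb1 : ∀ i, 1 ≤ b i) {y : ℝ} (hy : y ∈ Set.Icc (0 : ℝ) 1) (n : ℕ) :
    greedyRem b y n ∈ Set.Icc (0 : ℝ) 1 := by
  induction n with
  | zero => exact hy
  | succ n ih =>
    have h1 : (1 : ℝ) ≤ b n := by exact_mod_cast hb1 n
    have h0 : 0 ≤ greedyRem b y n * b n := mul_nonneg ih.1 (by linarith)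
    have hle : greedyRem b y n * b n ≤ b n := mul_le_of_le_one_left (by linarith) ih.2
    have hf := Nat.floor_le h0
    have hf' := Nat.lt_floor_add_one (greedyRem b y n * b n)
    rw [greedyRem, Nat.cast_min, Nat.cast_sub (hb1 n), Nat.cast_one]
    constructor
    · linarith [min_le_left (⌊greedyRem b y n * b n⌋₊ : ℝ) (b n - 1)]
    · rcases min_choice (⌊greedyRem b y n * b n⌋₊ : ℝ) (b n - 1) with h | h <;> rw [h] <;> linarith

theorem greedyDigit_mem_prodSet (hb1 : ∀ i, 1 ≤ b i) (y : ℝ) : greedyDigit b y ∈ prodSet b :=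
  fun n => (min_le_right _ _).trans_lt (Nat.sub_lt (hb1 n) one_pos)

theorem prefixCode_greedyDigit (y : ℝ) (n : ℕ) :
    (prefixCode b (greedyDigit b y) n : ℝ) + greedyRem b y n = y * basePow b n := by
  induction n with
  | zero => simp [prefixCode, greedyRem, basePow]
  | succ n ih =>
    rw [prefixCode, greedyRem, basePow_succ, ← greedyDigit]
    push_cast
    linear_combination (b n : ℝ) * ih

theorem Fb_greedyDigit (hb1 : ∀ i, 1 ≤ b i) (hb2 : ∀ m, ∃ i ≥ m, 2 ≤ b i) {y : ℝ}
    (hy : y ∈ Set.Icc (0 : ℝ) 1) : Fb b (greedyDigit b y) = y := by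
  have hx := greedyDigit_mem_prodSet hb1 y
  refine tendsto_nhds_unique (summable_Fb hb1 hx).hasSum.tendsto_sum_nat ?_
  have hlim : Filter.Tendsto (fun n => y - 1 / (basePow b n : ℝ)) Filter.atTop (nhds y) := by
    simpa using ((tendsto_basePow hb1 hb2).inv_tendsto_atTop).const_sub y
  refine tendsto_of_tendsto_of_tendsto_of_le_of_le hlim tendsto_const_nhds ?_ ?_ <;> intro n <;>
    simp only [sum_range_eq_prefixCode_div hb1]
  all_goals
    have h0 : (0 : ℝ) < basePow b n := by exact_mod_cast basePow_pos hb1 n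
    have hr := greedyRem_mem_Icc hb1 hy n
    have hcode := prefixCode_greedyDigit (b := b) y n
  · rw [sub_le_iff_le_add, ← add_div, le_div_iff₀ h0]
    linarith [hr.2]
  · rw [div_le_iff₀ h0]
    linarith [hr.1]

theorem image_Fb_inter_preimage (hb1 : ∀ i, 1 ≤ b i) (hb2 : ∀ m, ∃ i ≥ m, 2 ≤ b i) {Y : Set ℝ}
    (hY : Y ⊆ Set.Icc (0 : ℝ) 1) : Fb b '' (prodSet b ∩ Fb b ⁻¹' Y) = Y := by
  refine Set.Subset.antisymm (by rintro _ ⟨x, hx, rfl⟩; exact hx.2) fun y hy => ?_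
  have h := Fb_greedyDigit hb1 hb2 (hY hy)
  exact ⟨greedyDigit b y, ⟨greedyDigit_mem_prodSet hb1 y, by rwa [Set.mem_preimage, h]⟩, h⟩

theorem SMZb.smzReal_image (hb1 : ∀ i, 1 ≤ b i) (hb2 : ∀ m, ∃ i ≥ m, 2 ≤ b i)
    {X : Set (ℕ → ℕ)} (hX : SMZb b X) : SMZReal (Fb b '' X) := by
  intro ε hε
  have hf : ∀ n, ∃ N, 1 / (basePow b N : ℝ) ≤ ε n := fun n => by
    obtain ⟨N, hN⟩ := ((tendsto_basePow hb1 hb2).eventually_ge_atTop (1 / ε n)).exists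
    exact ⟨N, one_div_le (hε n) (by exact_mod_cast basePow_pos hb1 N) |>.mp hN⟩
  choose f hf using hf
  obtain ⟨σ, hσ, hcov⟩ := hX f
  let code n : ℝ := prefixCode b (fun i => (σ n).getD i 0) (f n)
  refine ⟨fun n => code n / basePow b (f n), fun n => (code n + 1) / basePow b (f n), ?_, ?_⟩
  · intro n
    rw [← sub_div, add_sub_cancel_left]
    exact hf n
  · rintro _ ⟨x, hxX, rfl⟩
    obtain ⟨n, hx, hxσ⟩ := Set.mem_iUnion.mp (hcov hxX)
    have hcode : code n = prefixCode b x (f n) := by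
      refine congrArg Nat.cast (prefixCode_congr fun i hi => ?_)
      have hi' : i < (σ n).length := by rwa [(hσ n).2]
      simpa [hi'] using hxσ ⟨i, hi'⟩
    refine Set.mem_iUnion.mpr ⟨n, ?_⟩
    simp only [hcode]
    exact ⟨prefixCode_div_le_Fb hb1 hx _, Fb_le_prefixCode_add_one_div hb1 hx _⟩

/-- The points of `∏b` whose prefix of length `N ≥ l` has a given code lie in a single cylinder of
length `l`. -/
theorem exists_cyl_of_prefixCode (hb1 : ∀ i, 1 ≤ b i) {l N : ℕ} (hl : l ≤ N) (m : ℕ) :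
    ∃ s : List ℕ, (IsBSeq b s ∧ s.length = l) ∧
      ∀ x ∈ prodSet b, prefixCode b x N = m → x ∈ cyl b s := by
  by_cases h : ∃ x ∈ prodSet b, prefixCode b x N = m
  · obtain ⟨z, hz, rfl⟩ := h
    refine ⟨List.ofFn fun i : Fin l => z i, ⟨fun i => ?_, by simp⟩,
      fun x hx hxz => ⟨hx, fun i => ?_⟩⟩
    · simpa using hz i
    · have hi : (i : ℕ) < l := by simpa using i.2
      simpa using eq_of_prefixCode_eq hz hx hxz.symm i (hi.trans_le hl)
  · refine ⟨List.replicate l 0, ⟨fun i => ?_, by simp⟩, fun x hx hxm => (h ⟨x, hx, hxm⟩).elim⟩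
    simpa using Nat.pos_of_ne_zero (Nat.one_le_iff_ne_zero.mp (hb1 i))

/-- An interval shorter than `1 / basePow b N` meets the images of at most two cylinders of
length `N`, and these are neighbours. -/
theorem prefixCode_eq_or_of_mem_Icc (hb1 : ∀ i, 1 ≤ b i) {a c : ℝ} {N : ℕ}
    (hac : c - a ≤ 1 / (2 * basePow b N)) {x : ℕ → ℕ} (hx : x ∈ prodSet b)
    (hF : Fb b x ∈ Set.Icc a c) :
    prefixCode b x N = ⌈a * basePow b N - 1⌉₊ ∨ prefixCode b x N = ⌈a * basePow b N - 1⌉₊ + 1 := by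
  have h0 : (0 : ℝ) < basePow b N := by exact_mod_cast basePow_pos hb1 N
  have h1 := (prefixCode_div_le_Fb hb1 hx N).trans hF.2
  have h2 := hF.1.trans (Fb_le_prefixCode_add_one_div hb1 hx N)
  rw [div_le_iff₀ h0] at h1
  rw [le_div_iff₀ h0] at h2
  rw [le_div_iff₀ (by positivity)] at hac
  have h3 : ⌈a * basePow b N - 1⌉₊ ≤ prefixCode b x N := Nat.ceil_le.mpr (by linarith)
  have h4 : prefixCode b x N < ⌈a * basePow b N - 1⌉₊ + 2 := by
    have h5 := Nat.le_ceil (a * basePow b N - 1)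
    rify
    nlinarith
  omega

theorem SMZReal.smzb_of_image (hb1 : ∀ i, 1 ≤ b i) {X : Set (ℕ → ℕ)} (hXb : X ⊆ prodSet b)
    (hX : SMZReal (Fb b '' X)) : SMZb b X := by
  intro f
  let N n := max (f (2 * n)) (f (2 * n + 1))
  obtain ⟨a, c, hac, hcov⟩ := hX (fun n => 1 / (2 * basePow b (N n))) fun n => by
    have : (0 : ℝ) < basePow b (N n) := by exact_mod_cast basePow_pos hb1 (N n)
    positivity
  have hle k : f k ≤ N (k / 2) := by
    rcases Nat.even_or_odd' k with ⟨j, rfl | rfl⟩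
    · rw [Nat.mul_div_cancel_left _ two_pos]
      exact le_max_left _ _
    · rw [Nat.mul_add_div two_pos]
      exact le_max_right _ _
  choose σ hσ hcyl using fun k => exists_cyl_of_prefixCode hb1 (hle k)
    (⌈a (k / 2) * basePow b (N (k / 2)) - 1⌉₊ + k % 2)
  refine ⟨σ, hσ, fun x hxX => ?_⟩
  have hx := hXb hxX
  obtain ⟨n, hn⟩ := Set.mem_iUnion.mp (hcov ⟨x, hxX, rfl⟩)
  rw [Set.mem_iUnion]
  rcases prefixCode_eq_or_of_mem_Icc hb1 (hac n) hx hn with h | h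
  · refine ⟨2 * n, hcyl _ x hx ?_⟩
    rw [Nat.mul_div_cancel_left _ two_pos, Nat.mul_mod_right, h, add_zero]
  · refine ⟨2 * n + 1, hcyl _ x hx ?_⟩
    rw [Nat.mul_add_div two_pos, Nat.mul_add_mod]
    simpa using h

theorem smzb_iff_smzReal_image (hb1 : ∀ i, 1 ≤ b i) (hb2 : ∀ m, ∃ i ≥ m, 2 ≤ b i)
    {X : Set (ℕ → ℕ)} (hXb : X ⊆ prodSet b) : SMZb b X ↔ SMZReal (Fb b '' X) :=
  ⟨SMZb.smzReal_image hb1 hb2, SMZReal.smzb_of_image hb1 hXb⟩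

end

/-- `F_b` preserves strong measure zero via images and preimages: for `X ⊆ ∏b`,
`X` has strong measure zero in `∏b` iff `F_b[X]` has strong measure zero in `[0,1]`;
and for `Y ⊆ [0,1]`, `Y` has strong measure zero in `[0,1]` iff `F_b⁻¹(Y)` has
strong measure zero in `∏b`. -/
theorem stmt11 (b : ℕ → ℕ) (hb1 : ∀ i, 1 ≤ b i) (hb2 : ∀ m, ∃ i ≥ m, 2 ≤ b i) :
    (∀ X ⊆ prodSet b, (SMZb b X ↔ SMZReal (Fb b '' X))) ∧
    (∀ Y ⊆ Set.Icc (0 : ℝ) 1, (SMZReal Y ↔ SMZb b (prodSet b ∩ Fb b ⁻¹' Y))) := by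
  refine ⟨fun X hX => smzb_iff_smzReal_image hb1 hb2 hX, fun Y hY => ?_⟩
  rw [smzb_iff_smzReal_image hb1 hb2 Set.inter_subset_left, image_Fb_inter_preimage hb1 hb2 hY]
end
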